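/- arXiv:0911.1664 — 9 statements merged into one kernel-verified Lean document; each statement's English description precedes it below -/
import Mathlib

section
/- In the Schrödinger setup, let s ∈ Ω be a zero of ψ. Then the limit as x → s (x ≠ s) of ω(x) − ħ/(x−s) exists and equals V′(s)/2; equivalently, the Bethe ansatz equation V′(s) = 2·lim_{x→s}(ω(x) − ħ/(x−s)) holds at every zero s of ψ. -/
open Topology Filter Polynomial

theorem bethe_aux (s : ℂ) (f g : ℂ → ℂ) (n : ℕ) (hg : AnalyticAt ℂ g s)
    (h : ∀ᶠ x in 𝓝 s, f x = (x - s) ^ (n + 1) * g x) :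
    ∀ᶠ x in 𝓝 s, deriv f x = (x - s) ^ n * ((n + 1 : ℂ) * g x + (x - s) * deriv g x) := by
  have h1 := h.eventually_nhds
  filter_upwards [h1, hg.eventually_analyticAt] with x hx hgx
  have e : f =ᶠ[𝓝 x] fun y => (y - s) ^ (n + 1) * g y := hx
  rw [e.deriv_eq]
  have d : HasDerivAt (fun y => (y - s) ^ (n + 1) * g y)
      (((n + 1 : ℕ) : ℂ) * (x - s) ^ n * 1 * g x + (x - s) ^ (n + 1) * deriv g x) x :=
    ((((hasDerivAt_id x).sub_const s).pow (n + 1))).mul hgx.differentiableAt.hasDerivAt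
  rw [d.deriv]
  push_cast
  ring

/-- Bethe ansatz: in the Schrödinger setup, at every zero `s` of `ψ`, the limit of
`ω(x) - hbar/(x-s)` as `x → s` exists and equals `V'(s)/2`, i.e.
`V'(s) = 2·lim_{x→s} (ω(x) - hbar/(x-s))`. -/
theorem bethe_ansatz
    (hbar : ℂ) (hhbar : hbar ≠ 0) (U V' : Polynomial ℂ)
    (Ω : Set ℂ) (hΩo : IsOpen Ω) (hΩc : IsConnected Ω)
    (ψ : ℂ → ℂ) (hψ : AnalyticOnNhd ℂ ψ Ω)
    (hne : ∃ x ∈ Ω, ψ x ≠ 0)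
    (hSch : ∀ x ∈ Ω, hbar ^ 2 * deriv (deriv ψ) x = U.eval x * ψ x)
    (s : ℂ) (hs : s ∈ Ω) (hs0 : ψ s = 0) :
    Tendsto (fun x => (hbar * deriv ψ x / ψ x + V'.eval x / 2) - hbar / (x - s))
      (𝓝[≠] s) (𝓝 (V'.eval s / 2)) := by
  have hnz : ¬ ∀ᶠ z in 𝓝 s, ψ z = 0 := by
    intro h
    obtain ⟨x, hx, hx0⟩ := hne
    exact hx0 (hψ.eqOn_zero_of_preconnected_of_eventuallyEq_zero hΩc.isPreconnected hs h hx)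
  obtain ⟨n, g, hg, hgs, hev⟩ := (hψ s hs).exists_eventuallyEq_pow_smul_nonzero_iff.mpr hnz
  simp only [smul_eq_mul] at hev
  obtain _ | m := n
  · have := hev.self_of_nhds
    simp [hs0] at this
    exact absurd this.symm (by simpa using hgs)
  have h1 := bethe_aux s ψ g m hg hev
  set k : ℂ → ℂ := fun x => (m + 1 : ℂ) * g x + (x - s) * deriv g x with hk
  have hka : AnalyticAt ℂ k s := by
    have := hg.deriv
    fun_prop
  have hks : k s = (m + 1 : ℂ) * g s := by simp [hk]
  have hΩn : ∀ᶠ x in 𝓝 s, x ∈ Ω := hΩo.mem_nhds hs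
  obtain _ | j := m
  · -- simple zero
    have hg0 : deriv g s = 0 := by
      have e : deriv ψ =ᶠ[𝓝 s] k := by
        filter_upwards [h1] with x hx
        simpa [hk] using hx
      have h2 := hSch s hs
      have hd : HasDerivAt k (deriv g s + deriv g s) s := by
        have a := (hg.differentiableAt.hasDerivAt.const_mul (((0:ℕ):ℂ) + 1)).add
          (((hasDerivAt_id s).sub_const s).mul hg.deriv.differentiableAt.hasDerivAt)
        refine a.congr_deriv ?_
        simp
      rw [e.deriv_eq, hd.deriv, hs0] at h2
      have : deriv g s + deriv g s = 0 := by simpa [hhbar] using h2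
      linear_combination this / 2
    have hT : Tendsto (fun x => hbar * (deriv g x / g x) + V'.eval x / 2) (𝓝[≠] s)
        (𝓝 (V'.eval s / 2)) := by
      have c : ContinuousAt (fun x => hbar * (deriv g x / g x) + V'.eval x / 2) s :=
        (continuousAt_const.mul (hg.deriv.continuousAt.div hg.continuousAt hgs)).add
          (V'.continuous.continuousAt.div_const 2)
      have := c.tendsto
      simp only [hg0, zero_div, mul_zero, zero_add] at this
      exact this.mono_left nhdsWithin_le_nhds
    refine hT.congr' ?_
    filter_upwards [nhdsWithin_le_nhds h1, nhdsWithin_le_nhds hev, self_mem_nhdsWithin,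
      nhdsWithin_le_nhds (hg.continuousAt.eventually_ne hgs)] with x a b c d
    have c' : x - s ≠ 0 := sub_ne_zero.mpr c
    rw [a, b]
    push_cast
    field_simp
    ring
  · exfalso
    have h2 := bethe_aux s (deriv ψ) k j hka h1
    have hE : ∀ᶠ x in 𝓝[≠] s, hbar ^ 2 * ((j + 1 : ℂ) * k x + (x - s) * deriv k x)
        = U.eval x * (x - s) ^ 2 * g x := by
      filter_upwards [nhdsWithin_le_nhds h2, nhdsWithin_le_nhds hev, self_mem_nhdsWithin,
        nhdsWithin_le_nhds hΩn] with x a b c d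
      have c' : (x - s) ^ j ≠ 0 := pow_ne_zero _ (sub_ne_zero.mpr c)
      have e := hSch x d
      rw [a, b] at e
      apply mul_left_cancel₀ c'
      linear_combination e
    have cL : ContinuousAt (fun x => hbar ^ 2 * ((j + 1 : ℂ) * k x + (x - s) * deriv k x)) s := by
      have := hka.continuousAt
      have := hka.deriv.continuousAt
      fun_prop
    have cR : ContinuousAt (fun x => U.eval x * (x - s) ^ 2 * g x) s := by
      have := hg.continuousAt
      have := U.continuous.continuousAt (x := s)
      fun_prop
    have := tendsto_nhds_unique
      ((cL.tendsto.mono_left nhdsWithin_le_nhds).congr' hE)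
      (cR.tendsto.mono_left (nhdsWithin_le_nhds (s := {s}ᶜ)))
    rw [hks] at this
    have p1 : (j : ℂ) + 1 ≠ 0 := Nat.cast_add_one_ne_zero j
    have p2 : ((j + 1 : ℕ) : ℂ) + 1 ≠ 0 := Nat.cast_add_one_ne_zero (j + 1)
    simp only [sub_self, zero_mul, add_zero, ne_eq, OfNat.ofNat_ne_zero, not_false_eq_true,
      zero_pow, mul_zero] at this
    exact mul_ne_zero (pow_ne_zero 2 hhbar) (mul_ne_zero p1 (mul_ne_zero p2 hgs)) this
end

section
/- In the Schrödinger setup, let s ∈ Ω be a zero of ψ (so that ψ′(s) ≠ 0). Then the residue of 1/ψ² at s vanishes: the function x ↦ (x−s)/ψ(x)² − 1/(ψ′(s)²·(x−s)) tends to 0 as x → s with x ≠ s. Equivalently, the analytic extension h at s of x ↦ (x−s)²/ψ(x)² satisfies h(s) = 1/ψ′(s)² and h′(s) = 0. -/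
open Topology Filter Polynomial

/-- Vanishing of the residue of `1/ψ²` at a zero `s` of `ψ`: the zero is simple,
`(x-s)/ψ(x)² - 1/(ψ'(s)²(x-s)) → 0` as `x → s`, and equivalently the analytic extension
`h` at `s` of `x ↦ (x-s)²/ψ(x)²` satisfies `h(s) = 1/ψ'(s)²` and `h'(s) = 0`. -/
theorem residue_of_inv_psi_sq_vanishes
    (hbar : ℂ) (hhbar : hbar ≠ 0) (U : Polynomial ℂ)
    (Ω : Set ℂ) (hΩo : IsOpen Ω) (hΩc : IsConnected Ω)
    (ψ : ℂ → ℂ) (hψ : AnalyticOnNhd ℂ ψ Ω)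
    (hne : ∃ x ∈ Ω, ψ x ≠ 0)
    (hSch : ∀ x ∈ Ω, hbar ^ 2 * deriv (deriv ψ) x = U.eval x * ψ x)
    (s : ℂ) (hs : s ∈ Ω) (hs0 : ψ s = 0) :
    deriv ψ s ≠ 0 ∧
    Tendsto (fun x => (x - s) / (ψ x) ^ 2 - 1 / ((deriv ψ s) ^ 2 * (x - s)))
      (𝓝[≠] s) (𝓝 0) ∧
    ∀ h : ℂ → ℂ, AnalyticAt ℂ h s →
      (∀ᶠ x in 𝓝[≠] s, h x = (x - s) ^ 2 / (ψ x) ^ 2) →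
      h s = 1 / (deriv ψ s) ^ 2 ∧ deriv h s = 0 := by
  have hA : AnalyticAt ℂ ψ s := hψ s hs
  have hA1 : AnalyticAt ℂ (deriv ψ) s := hA.deriv
  have hnear : ∀ᶠ x in 𝓝 s, x ∈ Ω := hΩo.mem_nhds hs
  have htop : analyticOrderAt ψ s ≠ ⊤ := by
    intro h
    rw [analyticOrderAt_eq_top] at h
    obtain ⟨x, hx, hx0⟩ := hne
    exact hx0 (hψ.eqOn_zero_of_preconnected_of_eventuallyEq_zero hΩc.isPreconnected hs h hx)
  have hd : deriv ψ s ≠ 0 := by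
    intro hd0
    have h1 := hA.analyticOrderAt_deriv_add_one
    have h2 := hA1.analyticOrderAt_deriv_add_one
    simp only [hs0, hd0, sub_zero] at h1 h2
    have hV : AnalyticAt ℂ (fun x => (hbar ^ 2)⁻¹ * U.eval x) s :=
      analyticAt_const.mul (U.differentiable.analyticAt s)
    have h3 : deriv (deriv ψ) =ᶠ[𝓝 s] (fun x => (hbar ^ 2)⁻¹ * U.eval x) * ψ := by
      filter_upwards [hnear] with x hx
      have := hSch x hx
      simp only [Pi.mul_apply]
      rw [mul_assoc, ← this]
      field_simp
    have h4 := analyticOrderAt_congr h3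
    rw [analyticOrderAt_mul hV hA] at h4
    obtain ⟨n, hn⟩ := ENat.ne_top_iff_exists.mp htop
    change analyticOrderAt (deriv ψ) s + 1 = analyticOrderAt ψ s at h1
    change analyticOrderAt (deriv (deriv ψ)) s + 1 = analyticOrderAt (deriv ψ) s at h2
    rw [← h2, h4, ← hn] at h1
    generalize analyticOrderAt (fun x => (hbar ^ 2)⁻¹ * U.eval x) s = a at h1
    cases a with
    | top => simp at h1
    | coe a =>
      norm_cast at h1
      omega
  have hord := hA.analyticOrderAt_eq_one_of_zero_deriv_ne_zero hs0 hd
  obtain ⟨g, hg, hg0, hgψ⟩ := (hA.analyticOrderAt_eq_natCast (n := 1)).mp (by simpa using hord)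
  have hgψ' : ψ =ᶠ[𝓝 s] fun x => (x - s) * g x := by
    filter_upwards [hgψ] with x hx
    simpa using hx
  have hder : deriv ψ =ᶠ[𝓝 s] fun x => g x + (x - s) * deriv g x := by
    filter_upwards [hgψ'.eventuallyEq_nhds, hg.eventually_analyticAt] with x hx hgx
    rw [hx.deriv_eq]
    have := ((hasDerivAt_id x).sub_const s).mul hgx.differentiableAt.hasDerivAt
    have h5 := this.deriv
    simp at h5
    exact h5
  have hds : deriv ψ s = g s := by simpa using hder.eq_of_nhds
  have hg1 : deriv g s = 0 := by
    have h1 := hder.deriv_eq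
    have h2 := hg.differentiableAt.hasDerivAt.add
      (((hasDerivAt_id s).sub_const s).mul hg.deriv.differentiableAt.hasDerivAt)
    have h3 : deriv (fun x => g x + (x - s) * deriv g x) s = deriv g s + deriv g s := by
      have h5 := h2.deriv
      simp at h5
      exact h5
    have h4 := hSch s hs
    rw [h1, h3, hs0, mul_zero] at h4
    have h5 : deriv g s + deriv g s = 0 := by
      simpa [hhbar] using h4
    linear_combination h5 / 2
  have hh0 : HasDerivAt (fun x => 1 / (g x) ^ 2) 0 s := by
    have h1 := (hg.differentiableAt.hasDerivAt.pow 2).inv (pow_ne_zero 2 hg0)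
    simp only [one_div]
    simp [hg1] at h1
    exact h1
  refine ⟨hd, ?_, ?_⟩
  · have h1 := hasDerivAt_iff_tendsto_slope.mp hh0
    refine h1.congr' ?_
    filter_upwards [self_mem_nhdsWithin, hgψ'.filter_mono nhdsWithin_le_nhds,
      (hg.continuousAt.eventually_ne hg0).filter_mono nhdsWithin_le_nhds] with x hx hx1 hx2
    have hxs : x - s ≠ 0 := sub_ne_zero.mpr hx
    rw [hx1, hds, slope_def_field]
    field_simp
  · intro h hh hheq
    have h1 : h =ᶠ[𝓝[≠] s] fun x => 1 / (g x) ^ 2 := by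
      filter_upwards [hheq, self_mem_nhdsWithin, hgψ'.filter_mono nhdsWithin_le_nhds,
        (hg.continuousAt.eventually_ne hg0).filter_mono nhdsWithin_le_nhds] with x hx0 hx hx1 hx2
      have hxs : x - s ≠ 0 := sub_ne_zero.mpr hx
      rw [hx0, hx1]
      field_simp
    have h2 := (hh.continuousAt.eventuallyEq_nhds_iff_eventuallyEq_nhdsNE hh0.continuousAt).mp h1
    exact ⟨by rw [h2.eq_of_nhds, hds], by rw [h2.deriv_eq, hh0.deriv]⟩
end

section
/- In the Schrödinger setup, let s ∈ Ω be a zero of ψ. Then (x−s)·(ω(x)² + ħ·ω′(x)) → ħ·V′(s) as x → s with x ≠ s; that is, the residue at s of ω² + ħω′ equals ħV′(s). -/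
open Topology Filter Polynomial

/-- At a zero `s` of `ψ`, the residue of `ω² + hbar·ω'` equals `hbar·V'(s)`, where
`ω = hbar·ψ'/ψ + V'/2` is the resolvent. -/
theorem residue_of_omega_sq_plus_hbar_omega_deriv
    (hbar : ℂ) (hhbar : hbar ≠ 0) (U V' : Polynomial ℂ)
    (Ω : Set ℂ) (hΩo : IsOpen Ω) (hΩc : IsConnected Ω)
    (ψ : ℂ → ℂ) (hψ : AnalyticOnNhd ℂ ψ Ω)
    (hne : ∃ x ∈ Ω, ψ x ≠ 0)
    (hSch : ∀ x ∈ Ω, hbar ^ 2 * deriv (deriv ψ) x = U.eval x * ψ x)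
    (s : ℂ) (hs : s ∈ Ω) (hs0 : ψ s = 0) :
    Tendsto (fun x => (x - s) *
        ((hbar * deriv ψ x / ψ x + V'.eval x / 2) ^ 2 +
          hbar * deriv (fun y => hbar * deriv ψ y / ψ y + V'.eval y / 2) x))
      (𝓝[≠] s) (𝓝 (hbar * V'.eval s)) := by
  have ha := hψ s hs
  have hΩn : ∀ᶠ x in 𝓝 s, x ∈ Ω := hΩo.mem_nhds hs
  have hnz : ¬ ∀ᶠ x in 𝓝 s, ψ x = 0 := by
    intro h
    obtain ⟨x, hx, hx0⟩ := hne
    exact hx0 (hψ.eqOn_zero_of_preconnected_of_eventuallyEq_zero hΩc.isPreconnected hs h hx)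
  have hev : ∀ᶠ x in 𝓝[≠] s, ψ x ≠ 0 :=
    ha.eventually_eq_zero_or_eventually_ne_zero.resolve_left hnz
  have hd : deriv ψ s ≠ 0 := by
    intro hd0
    have h1 := ha.analyticOrderAt_deriv_add_one
    have h2 := ha.deriv.analyticOrderAt_deriv_add_one
    simp only [hs0, hd0, sub_zero] at h1 h2
    have h3 : analyticOrderAt (deriv (deriv ψ)) s
        = analyticOrderAt ((fun x => U.eval x / hbar ^ 2) * ψ) s := by
      apply analyticOrderAt_congr
      filter_upwards [hΩn] with x hx
      have := hSch x hx
      simp only [Pi.mul_apply]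
      field_simp
      linear_combination this
    have hU : AnalyticAt ℂ (fun x => U.eval x / hbar ^ 2) s := by
      have : Differentiable ℂ (fun x => U.eval x / hbar ^ 2) := by fun_prop
      exact this.analyticAt s
    rw [analyticOrderAt_mul hU ha] at h3
    have h4 : analyticOrderAt ψ s ≠ ⊤ := by
      rwa [Ne, analyticOrderAt_eq_top]
    rw [← h2, h3] at h1
    generalize analyticOrderAt (fun x => U.eval x / hbar ^ 2) s = a at *
    change _ = analyticOrderAt ψ s at h1
    generalize analyticOrderAt ψ s = b at *
    lift b to ℕ using h4
    induction a with
    | top => simp at h1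
    | coe a => norm_cast at h1; omega
  have hslope : Tendsto (fun x => (x - s) * deriv ψ x / ψ x) (𝓝[≠] s) (𝓝 1) := by
    have h1 := (hasDerivAt_iff_tendsto_slope.1 ha.differentiableAt.hasDerivAt)
    have h2 : Tendsto (deriv ψ) (𝓝[≠] s) (𝓝 (deriv ψ s)) :=
      ha.deriv.continuousAt.tendsto.mono_left nhdsWithin_le_nhds
    have h3 := h2.div h1 hd
    rw [div_self hd] at h3
    refine h3.congr' ?_
    filter_upwards with x
    simp only [Pi.div_apply, slope_def_field, hs0, sub_zero]
    rw [div_div_eq_mul_div]; ring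
  have hpoly : ∀ p : Polynomial ℂ, Tendsto (fun x => p.eval x) (𝓝[≠] s) (𝓝 (p.eval s)) :=
    fun p => (p.continuous.tendsto s).mono_left nhdsWithin_le_nhds
  have hlim := ((hslope.mul (hpoly V')).const_mul hbar).add
    (hpoly ((X - C s) * (U + C (1/4) * V' ^ 2 + C (hbar / 2) * derivative V')))
  simp only [eval_mul, eval_sub, eval_X, eval_C, sub_self, zero_mul, add_zero, one_mul] at hlim
  refine hlim.congr' ?_
  filter_upwards [hev, hΩn.filter_mono nhdsWithin_le_nhds] with x hx hxΩ
  have e1 : HasDerivAt (fun y => hbar * deriv ψ y / ψ y + V'.eval y / 2)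
      ((hbar * deriv (deriv ψ) x * ψ x - hbar * deriv ψ x * deriv ψ x) / ψ x ^ 2
        + V'.derivative.eval x / 2) x :=
    (((hψ x hxΩ).deriv.differentiableAt.hasDerivAt.const_mul hbar).div
      (hψ x hxΩ).differentiableAt.hasDerivAt hx).add ((V'.hasDerivAt x).div_const 2)
  rw [e1.deriv]
  have h := hSch x hxΩ
  have hU : U.eval x = hbar ^ 2 * deriv (deriv ψ) x / ψ x := by
    rw [h]; field_simp
  simp only [eval_add, eval_mul, eval_pow, eval_C, hU]
  field_simp
  ring
end

section
/- Let ħ be a nonzero complex number, let V′ and P be polynomials with complex coefficients, and let p ∈ ℂ[X] be a nonconstant polynomial all of whose roots are simple, satisfying the differential equation ħ²·p″ − ħ·V′·p′ + P·p = 0 in ℂ[X]. Then every root s of p satisfies the Gaudin-model Bethe equation V′(s) = 2ħ · Σ_{s′} 1/(s−s′), where the sum runs over the roots s′ of p different from s. -/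
open Polynomial

/-- Gaudin Bethe equations: if a nonconstant polynomial `p` with only simple roots satisfies
`hbar²·p'' - hbar·V'·p' + P·p = 0`, then every root `s` of `p` satisfies
`V'(s) = 2·hbar·Σ_{s' root, s' ≠ s} 1/(s - s')`. -/
theorem gaudin_bethe_equations
    (hbar : ℂ) (hhbar : hbar ≠ 0) (V' P : Polynomial ℂ)
    (p : Polynomial ℂ) (hdeg : 0 < p.natDegree)
    (hsimple : ∀ s : ℂ, p.eval s = 0 → (derivative p).eval s ≠ 0)
    (heq : C (hbar ^ 2) * derivative (derivative p) - C hbar * V' * derivative p + P * p = 0) :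
    ∀ s : ℂ, p.eval s = 0 →
      V'.eval s = 2 * hbar * ∑ s' ∈ p.roots.toFinset.erase s, 1 / (s - s') := by
  intro s hs
  have hp : p ≠ 0 := by
    rintro rfl
    simp at hdeg
  have hnodup : p.roots.Nodup := by
    rw [Multiset.nodup_iff_count_le_one]
    intro a
    rw [count_roots]
    by_contra hlt
    have h := (one_lt_rootMultiplicity_iff_isRoot hp).1 (not_le.1 hlt)
    exact hsimple a h.1 h.2
  obtain ⟨q, hq⟩ := dvd_iff_isRoot.2 (show p.IsRoot s from hs)
  have hq0 : (X - C s) * q ≠ 0 := hq ▸ hp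
  have hroots : p.roots = s ::ₘ q.roots := by
    rw [hq, roots_mul hq0, roots_X_sub_C, Multiset.singleton_add]
  have hd1 : (derivative p).eval s = q.eval s := by
    rw [hq]
    simp
  have hd2 : (derivative (derivative p)).eval s = 2 * (derivative q).eval s := by
    rw [hq]
    simp
    ring
  have hqs : q.eval s ≠ 0 := hd1 ▸ hsimple s hs
  have hsum : ∑ s' ∈ p.roots.toFinset.erase s, 1 / (s - s')
      = (derivative q).eval s / q.eval s := by
    rw [(IsAlgClosed.splits q).eval_derivative_div_eval_of_ne_zero hqs]
    rw [hroots, Multiset.nodup_cons] at hnodup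
    have h1 : p.roots.toFinset.erase s = ⟨q.roots, hnodup.2⟩ := by
      ext a
      rw [hroots]
      simp only [Finset.mem_erase, Multiset.mem_toFinset, Multiset.mem_cons, Finset.mem_mk]
      constructor
      · rintro ⟨h, h' | h'⟩
        · exact absurd h' h
        · exact h'
      · intro h
        exact ⟨fun e => hnodup.1 (e ▸ h), Or.inr h⟩
    rw [h1]
    rfl
  have he := congrArg (eval s) heq
  simp only [eval_add, eval_sub, eval_mul, eval_C, eval_zero, hd1, hd2, hs] at he
  rw [hsum]
  field_simp
  apply mul_left_cancel₀ hhbar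
  linear_combination -he
end

section
/- Let Ω ⊆ ℂ be open, let ψ : ℂ → ℂ be analytic and nonvanishing on Ω, and set Y := ψ′/ψ. Let D be an open subset of {(x,z) ∈ Ω×Ω : x ≠ z}, and let k : ℂ×ℂ → ℂ be analytic in each variable on D with all mixed partial derivatives up to total order 3 continuous and commuting, satisfying 2Y(x)·k(x,z) + ∂ₓk(x,z) = 1/(x−z) on D. Define b(x,z) := (1/2)·∂_z( 2Y(z)·k(x,z) − ∂_z k(x,z) ). Then for all (x,z) ∈ D: 2Y(x)·( b(x,z) − 1/(2(x−z)²) ) + ∂ₓ( b(x,z) − 1/(2(x−z)²) ) + ∂_z( (Y(x)−Y(z))/(x−z) ) = 0. -/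
open Topology

/-- Partial derivative of a two-variable complex function in the first variable. -/
noncomputable def pdx (k : ℂ → ℂ → ℂ) (x z : ℂ) : ℂ := deriv (fun x' => k x' z) x

/-- Partial derivative of a two-variable complex function in the second variable. -/
noncomputable def pdz (k : ℂ → ℂ → ℂ) (x z : ℂ) : ℂ := deriv (fun z' => k x z') z

/-- The bare Bergman kernel `b(x,z) = (1/2)·∂_z(2Y(z)·k(x,z) - ∂_z k(x,z))` built from a
recursion kernel `k` and `Y`. -/
noncomputable def bareBergman (Y : ℂ → ℂ) (k : ℂ → ℂ → ℂ) (x z : ℂ) : ℂ :=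
  (1 / 2) * deriv (fun z' => 2 * Y z' * k x z' - pdz k x z') z

/-- Loop equation (in the variable `x`) for the bare Bergman kernel: if `ψ` is analytic and
nonvanishing on `Ω`, `Y = ψ'/ψ`, and `k` is analytic in each variable on `D` with mixed
partials up to total order 3 commuting, and satisfies `2Y(x)k(x,z) + ∂ₓk(x,z) = 1/(x-z)`,
then `b(x,z) = (1/2)∂_z(2Y(z)k(x,z) - ∂_z k(x,z))` satisfies
`2Y(x)(b - 1/(2(x-z)²)) + ∂ₓ(b - 1/(2(x-z)²)) + ∂_z((Y(x)-Y(z))/(x-z)) = 0`. -/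
theorem loop_equation_bare_bergman
    (Ω : Set ℂ) (hΩ : IsOpen Ω)
    (ψ : ℂ → ℂ) (hψ : AnalyticOnNhd ℂ ψ Ω) (hψ0 : ∀ x ∈ Ω, ψ x ≠ 0)
    (Y : ℂ → ℂ) (hY : Y = fun x => deriv ψ x / ψ x)
    (D : Set (ℂ × ℂ)) (hDo : IsOpen D)
    (hD : D ⊆ {p : ℂ × ℂ | p.1 ∈ Ω ∧ p.2 ∈ Ω ∧ p.1 ≠ p.2})
    (k : ℂ → ℂ → ℂ)
    (hkx : ∀ x z : ℂ, (x, z) ∈ D → AnalyticAt ℂ (fun x' => k x' z) x)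
    (hkz : ∀ x z : ℂ, (x, z) ∈ D → AnalyticAt ℂ (fun z' => k x z') z)
    (hkzx : ∀ x z : ℂ, (x, z) ∈ D → AnalyticAt ℂ (fun x' => pdz k x' z) x)
    (hkzzx : ∀ x z : ℂ, (x, z) ∈ D → AnalyticAt ℂ (fun x' => pdz (pdz k) x' z) x)
    (hcomm1 : ∀ x z : ℂ, (x, z) ∈ D → pdz (pdx k) x z = pdx (pdz k) x z)
    (hcomm2 : ∀ x z : ℂ, (x, z) ∈ D → pdz (pdz (pdx k)) x z = pdx (pdz (pdz k)) x z)
    (hker : ∀ x z : ℂ, (x, z) ∈ D → 2 * Y x * k x z + pdx k x z = 1 / (x - z)) :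
    ∀ x z : ℂ, (x, z) ∈ D →
      2 * Y x * (bareBergman Y k x z - 1 / (2 * (x - z) ^ 2)) +
        deriv (fun x' => bareBergman Y k x' z - 1 / (2 * (x' - z) ^ 2)) x +
        deriv (fun z' => (Y x - Y z') / (x - z')) z = 0 := by
  intro x z hxz
  have hYa : ∀ w ∈ Ω, AnalyticAt ℂ Y w := by
    intro w hw
    rw [hY]
    exact (hψ w hw).deriv.div (hψ w hw) (hψ0 w hw)
  have hkzz : ∀ x z : ℂ, (x, z) ∈ D → AnalyticAt ℂ (fun z' => pdz k x z') z :=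
    fun x z h => (hkz x z h).deriv
  have hne : ∀ x z : ℂ, (x, z) ∈ D → x - z ≠ 0 := fun x z h => sub_ne_zero.2 (hD h).2.2
  have evx : ∀ x z : ℂ, (x, z) ∈ D → ∀ᶠ x' in 𝓝 x, (x', z) ∈ D := by
    intro x z h
    have hc : ContinuousAt (fun x' : ℂ => (x', z)) x := by fun_prop
    exact hc.eventually (hDo.mem_nhds h)
  have evz : ∀ x z : ℂ, (x, z) ∈ D → ∀ᶠ z' in 𝓝 z, (x, z') ∈ D := by
    intro x z h
    have hc : ContinuousAt (fun z' : ℂ => (x, z')) z := by fun_prop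
    exact hc.eventually (hDo.mem_nhds h)
  have dk : ∀ x z : ℂ, (x, z) ∈ D → HasDerivAt (fun z' => k x z') (pdz k x z) z :=
    fun x z h => (hkz x z h).differentiableAt.hasDerivAt
  have dkk : ∀ x z : ℂ, (x, z) ∈ D → HasDerivAt (fun z' => pdz k x z') (pdz (pdz k) x z) z :=
    fun x z h => (hkzz x z h).differentiableAt.hasDerivAt
  have dY : ∀ w ∈ Ω, HasDerivAt Y (deriv Y w) w :=
    fun w h => (hYa w h).differentiableAt.hasDerivAt
  have hb : ∀ x z : ℂ, (x, z) ∈ D → bareBergman Y k x z =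
      deriv Y z * k x z + Y z * pdz k x z - 1 / 2 * pdz (pdz k) x z := by
    intro x z h
    have := ((((dY z (hD h).2.1).const_mul 2).mul (dk x z h)).sub (dkk x z h)).deriv
    unfold bareBergman
    have e : deriv (fun z' => 2 * Y z' * k x z' - pdz k x z') z = _ := this
    rw [e]
    ring
  have hkx1 : ∀ x z : ℂ, (x, z) ∈ D → pdx k x z = (x - z)⁻¹ - 2 * Y x * k x z := by
    intro x z h
    rw [← one_div, ← hker x z h]; ring
  have dinv : ∀ x z : ℂ, (x, z) ∈ D →
      HasDerivAt (fun z' => (x - z')⁻¹) (((x - z) ^ 2)⁻¹) z := by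
    intro x z h
    have := ((hasDerivAt_id z).const_sub x).fun_inv (hne x z h)
    refine HasDerivAt.congr_deriv this ?_
    simp
  have hkzx1 : ∀ x z : ℂ, (x, z) ∈ D →
      pdz (pdx k) x z = ((x - z) ^ 2)⁻¹ - 2 * Y x * pdz k x z := by
    intro x z h
    have e : (fun z' => pdx k x z') =ᶠ[𝓝 z] fun z' => (x - z')⁻¹ - 2 * Y x * k x z' :=
      (evz x z h).mono fun z' h' => hkx1 x z' h'
    unfold pdz
    rw [e.deriv_eq]
    exact ((dinv x z h).sub ((dk x z h).const_mul (2 * Y x))).deriv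
  have dinv2 : ∀ x z : ℂ, (x, z) ∈ D →
      HasDerivAt (fun z' => ((x - z') ^ 2)⁻¹) (2 / (x - z) ^ 3) z := by
    intro x z h
    have h0 := hne x z h
    have := (((hasDerivAt_id z).const_sub x).fun_pow 2).fun_inv (pow_ne_zero 2 h0)
    refine HasDerivAt.congr_deriv this ?_
    simp
    field_simp
  have hkzzx1 : pdz (pdz (pdx k)) x z = 2 / (x - z) ^ 3 - 2 * Y x * pdz (pdz k) x z := by
    have e : (fun z' => pdz (pdx k) x z') =ᶠ[𝓝 z]
        fun z' => ((x - z') ^ 2)⁻¹ - 2 * Y x * pdz k x z' :=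
      (evz x z hxz).mono fun z' h' => hkzx1 x z' h'
    have e2 : pdz (pdz (pdx k)) x z = deriv (fun z' => pdz (pdx k) x z') z := rfl
    rw [e2, e.deriv_eq]
    exact ((dinv2 x z hxz).sub ((dkk x z hxz).const_mul (2 * Y x))).deriv
  have h0 := hne x z hxz
  have d1 : HasDerivAt (fun x' => k x' z) (pdx k x z) x :=
    (hkx x z hxz).differentiableAt.hasDerivAt
  have d2 : HasDerivAt (fun x' => pdz k x' z) (pdx (pdz k) x z) x :=
    (hkzx x z hxz).differentiableAt.hasDerivAt
  have d3 : HasDerivAt (fun x' => pdz (pdz k) x' z) (pdx (pdz (pdz k)) x z) x :=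
    (hkzzx x z hxz).differentiableAt.hasDerivAt
  have d4 : HasDerivAt (fun x' => 1 / (2 * (x' - z) ^ 2)) (-(1 / (x - z) ^ 3)) x := by
    have := ((((hasDerivAt_id x).sub_const z).fun_pow 2).const_mul 2).fun_inv
      (mul_ne_zero two_ne_zero (pow_ne_zero 2 h0))
    simp only [one_div]
    refine HasDerivAt.congr_deriv this ?_
    simp
    field_simp
    try norm_num
  have E1 : deriv (fun x' => bareBergman Y k x' z - 1 / (2 * (x' - z) ^ 2)) x =
      deriv Y z * pdx k x z + Y z * pdx (pdz k) x z - 1 / 2 * pdx (pdz (pdz k)) x z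
        - (-(1 / (x - z) ^ 3)) := by
    have e : (fun x' => bareBergman Y k x' z - 1 / (2 * (x' - z) ^ 2)) =ᶠ[𝓝 x]
        fun x' => deriv Y z * k x' z + Y z * pdz k x' z - 1 / 2 * pdz (pdz k) x' z
          - 1 / (2 * (x' - z) ^ 2) :=
      (evx x z hxz).mono fun x' h' => by simp only [hb x' z h']
    rw [e.deriv_eq]
    exact ((((d1.const_mul _).add (d2.const_mul _)).sub (d3.const_mul _)).sub d4).deriv
  have E2 : deriv (fun z' => (Y x - Y z') / (x - z')) z =
      -deriv Y z * (x - z)⁻¹ + (Y x - Y z) * ((x - z) ^ 2)⁻¹ := by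
    simp only [div_eq_mul_inv]
    exact (((dY z (hD hxz).2.1).const_sub (Y x)).mul (dinv x z hxz)).deriv
  rw [E1, E2, hb x z hxz, ← hcomm1 x z hxz, ← hcomm2 x z hxz, hkzzx1, hkzx1 x z hxz,
    hkx1 x z hxz]
  field_simp
  ring
end

section
/- Let Ω ⊆ ℂ be open and let Y : ℂ → ℂ be twice differentiable on Ω. Set U := Y′ + Y² and U′ := Y″ + 2YY′, and define W(x,z) := (Y(x)−Y(z))/(x−z) for x ≠ z in Ω. Then for all x ≠ z in Ω: [2Y(z)·∂_zW(x,z) + ∂_z²W(x,z)] − [2Y(x)·∂ₓW(x,z) + ∂ₓ²W(x,z)] = 2(U(x)−U(z))/(x−z)² − (U′(x)+U′(z))/(x−z). -/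
theorem bergman_aux (Ω : Set ℂ) (hΩ : IsOpen Ω)
    (Y Y' Y'' : ℂ → ℂ)
    (hY : ∀ x ∈ Ω, HasDerivAt Y (Y' x) x)
    (hY' : ∀ x ∈ Ω, HasDerivAt Y' (Y'' x) x) (a c x : ℂ) (hx : x ∈ Ω) (hxa : x ≠ a) :
    deriv (fun t => (Y t - c) / (t - a)) x = (Y' x * (x - a) - (Y x - c)) / (x - a) ^ 2 ∧
    deriv (fun s => deriv (fun t => (Y t - c) / (t - a)) s) x =
      Y'' x / (x - a) - 2 * Y' x / (x - a) ^ 2 + 2 * (Y x - c) / (x - a) ^ 3 := by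
  have h1 : ∀ s ∈ Ω, s ≠ a → deriv (fun t => (Y t - c) / (t - a)) s
      = (Y' s * (s - a) - (Y s - c)) / (s - a) ^ 2 := by
    intro s hs hsa
    have := ((hY s hs).sub_const c).fun_div ((hasDerivAt_id' s).sub_const a) (sub_ne_zero.2 hsa)
    rw [this.deriv, mul_one]
  refine ⟨h1 x hx hxa, ?_⟩
  have hev : (fun s => deriv (fun t => (Y t - c) / (t - a)) s) =ᶠ[nhds x]
      fun s => (Y' s * (s - a) - (Y s - c)) / (s - a) ^ 2 := by
    filter_upwards [hΩ.mem_nhds hx, isOpen_ne.mem_nhds hxa] with s hs hsa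
    exact h1 s hs hsa
  have hd : x - a ≠ 0 := sub_ne_zero.2 hxa
  have hl := (hasDerivAt_id' x).sub_const a
  have := (((hY' x hx).fun_mul hl).fun_sub ((hY x hx).sub_const c)).fun_div (hl.fun_pow 2)
    (pow_ne_zero 2 hd)
  rw [hev.deriv_eq, this.deriv]
  field_simp
  push_cast
  ring

/-- Key identity for the symmetry of the Bergman kernel: with `W(x,z) = (Y(x)-Y(z))/(x-z)`,
`U = Y' + Y²` and `U' = Y'' + 2YY'`, one has
`(2Y(z)∂_z + ∂_z²)W - (2Y(x)∂ₓ + ∂ₓ²)W = 2(U(x)-U(z))/(x-z)² - (U'(x)+U'(z))/(x-z)`. -/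
theorem bergman_symmetry_identity
    (Ω : Set ℂ) (hΩ : IsOpen Ω)
    (Y Y' Y'' : ℂ → ℂ)
    (hY : ∀ x ∈ Ω, HasDerivAt Y (Y' x) x)
    (hY' : ∀ x ∈ Ω, HasDerivAt Y' (Y'' x) x) :
    ∀ x ∈ Ω, ∀ z ∈ Ω, x ≠ z →
      (2 * Y z * deriv (fun z' => (Y x - Y z') / (x - z')) z +
          deriv (fun z' => deriv (fun z'' => (Y x - Y z'') / (x - z'')) z') z) -
        (2 * Y x * deriv (fun x' => (Y x' - Y z) / (x' - z)) x +
          deriv (fun x' => deriv (fun x'' => (Y x'' - Y z) / (x'' - z)) x') x) =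
      2 * ((Y' x + Y x ^ 2) - (Y' z + Y z ^ 2)) / (x - z) ^ 2 -
        ((Y'' x + 2 * Y x * Y' x) + (Y'' z + 2 * Y z * Y' z)) / (x - z) := by
  intro x hx z hz hxz
  have hs : (fun t => (Y x - Y t) / (x - t)) = fun t => (Y t - Y x) / (t - x) := by
    funext t
    rw [← neg_sub (Y t), ← neg_sub t, neg_div_neg_eq]
  obtain ⟨a1, a2⟩ := bergman_aux Ω hΩ Y Y' Y'' hY hY' z (Y z) x hx hxz
  obtain ⟨b1, b2⟩ := bergman_aux Ω hΩ Y Y' Y'' hY hY' x (Y x) z hz hxz.symm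
  rw [hs, a1, a2, b1, b2]
  have hd : x - z ≠ 0 := sub_ne_zero.2 hxz
  rw [← neg_sub x z]
  generalize hD : x - z = d at *
  field_simp
  ring
end

section
/- Let N be a positive integer, let λ : Fin N → ℂ have pairwise distinct values, and let x ∈ ℂ with x ≠ λᵢ for all i. Then Σᵢ Σ_{j≠i} 2/((x−λᵢ)(λᵢ−λⱼ)) = ( Σᵢ 1/(x−λᵢ) )² − Σᵢ 1/(x−λᵢ)². -/
/-- Partial-fraction symmetrization identity used in the derivation of the loop equations:
for pairwise distinct `λᵢ` and `x` different from all of them,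
`Σᵢ Σ_{j≠i} 2/((x-λᵢ)(λᵢ-λⱼ)) = (Σᵢ 1/(x-λᵢ))² - Σᵢ 1/(x-λᵢ)²`. -/
theorem partial_fraction_symmetrization
    (N : ℕ) (hN : 0 < N) (l : Fin N → ℂ) (hl : Function.Injective l)
    (x : ℂ) (hx : ∀ i, x ≠ l i) :
    ∑ i, ∑ j ∈ Finset.univ.erase i, 2 / ((x - l i) * (l i - l j)) =
      (∑ i, 1 / (x - l i)) ^ 2 - ∑ i, 1 / (x - l i) ^ 2 := by
  have h1 : ∀ i, ∑ j ∈ Finset.univ.erase i, 2 / ((x - l i) * (l i - l j)) =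
      ∑ j, 2 / ((x - l i) * (l i - l j)) := by
    intro i
    apply Finset.sum_erase
    simp
  have h2 : ∀ i j, 1 / ((x - l i) * (l i - l j)) + 1 / ((x - l j) * (l j - l i)) =
      1 / (x - l i) * (1 / (x - l j)) - if i = j then 1 / (x - l i) ^ 2 else 0 := by
    intro i j
    have hi := sub_ne_zero.mpr (hx i)
    have hj := sub_ne_zero.mpr (hx j)
    by_cases h : i = j
    · subst h
      simp [sq]
    · have h3 : l i - l j ≠ 0 := sub_ne_zero.mpr (fun e => h (hl e))
      have h4 : l j - l i = -(l i - l j) := by ring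
      rw [if_neg h, h4]
      field_simp
      ring
  have h5 : ∑ i, ∑ j, 2 / ((x - l i) * (l i - l j)) =
      ∑ i, ∑ j, 1 / ((x - l i) * (l i - l j)) + ∑ i, ∑ j, 1 / ((x - l j) * (l j - l i)) := by
    rw [Finset.sum_comm (f := fun i j => 1 / ((x - l j) * (l j - l i)))]
    simp only [← Finset.sum_add_distrib]
    refine Finset.sum_congr rfl fun i _ => Finset.sum_congr rfl fun j _ => ?_
    ring
  simp only [h1]
  rw [h5]
  simp only [← Finset.sum_add_distrib, h2]
  simp only [Finset.sum_sub_distrib]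
  rw [sq, Finset.sum_mul_sum]
  simp
end

section
/- Let N be a positive integer, β > 0 and t₀ > 0 real numbers, and V a polynomial with real coefficients of even degree at least 2 with positive leading coefficient. On ℝᴺ consider the finite measure dμ(λ) = Π_{1≤i<j≤N} |λᵢ−λⱼ|^{2β} · exp( −(N√β/t₀)·Σ_{i=1}^N V(λᵢ) ) dλ. Then for every x ∈ ℂ with nonzero imaginary part, the following functions are μ-integrable and: (1−β)·∫ Σᵢ 1/(x−λᵢ)² dμ + β·∫ ( Σᵢ 1/(x−λᵢ) )² dμ = (N√β/t₀)·∫ Σᵢ V′(λᵢ)/(x−λᵢ) dμ. -/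
open MeasureTheory Polynomial

theorem aux_half (V q : Polynomial ℝ) (c : ℝ) (hc : 0 < c) (hVdeg : 2 ≤ V.natDegree)
    (hVlead : 0 < V.leadingCoeff) :
    IntegrableOn (fun a : ℝ => q.eval a * Real.exp (-c * V.eval a)) (Set.Ioi 0) := by
  have hc2 : 0 < c / 2 := by positivity
  refine integrable_of_isBigO_exp_neg hc2 (by fun_prop) ?_
  have hV : ∀ᶠ a : ℝ in Filter.atTop, a ≤ V.eval a := by
    have hd : (X : ℝ[X]).degree < V.degree := by
      rw [degree_X]
      have : V ≠ 0 := by rintro rfl; simp at hVdeg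
      rw [degree_eq_natDegree this]
      exact_mod_cast hVdeg
    have h := tendsto_atTop_of_leadingCoeff_nonneg (V - X)
      (by rw [degree_sub_eq_left_of_degree_lt hd]; exact lt_trans (by simp) hd)
      (by rw [leadingCoeff_sub_of_degree_lt hd]; exact hVlead.le)
    filter_upwards [h.eventually_ge_atTop 0] with a ha
    simpa using ha
  have hq : (fun a : ℝ => q.eval a) =O[Filter.atTop] fun a => Real.exp (c / 2 * a) := by
    have h1 : (fun a : ℝ => q.eval a) =O[Filter.atTop] fun a => a ^ q.natDegree := by
      have := isBigO_atTop_of_degree_le q (X ^ q.natDegree) (by simp)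
      simpa using this
    exact h1.trans (isLittleO_pow_exp_pos_mul_atTop _ hc2).isBigO
  have he : (fun a : ℝ => Real.exp (-c * V.eval a)) =O[Filter.atTop] fun a => Real.exp (-c * a) := by
    refine Asymptotics.IsBigO.of_bound 1 ?_
    filter_upwards [hV] with a ha
    simp only [Real.norm_eq_abs, Real.abs_exp, one_mul]
    apply Real.exp_le_exp.2
    nlinarith
  refine (hq.mul he).congr_right fun a => ?_
  rw [← Real.exp_add]
  congr 1
  ring

theorem aux_one (V q : Polynomial ℝ) (c : ℝ) (hc : 0 < c) (hVdeg : 2 ≤ V.natDegree)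
    (hVeven : Even V.natDegree) (hVlead : 0 < V.leadingCoeff) :
    Integrable (fun a : ℝ => q.eval a * Real.exp (-c * V.eval a)) := by
  have h1 := aux_half V q c hc hVdeg hVlead
  have h2 := aux_half (V.comp (-X)) (q.comp (-X)) c hc
    (by rw [natDegree_comp]; simpa using hVdeg)
    (by rw [leadingCoeff_comp (by simp)]; simpa [hVeven.neg_one_pow] using hVlead)
  rw [← integrableOn_univ, ← Set.Iic_union_Ioi (a := (0 : ℝ)), integrableOn_union]
  refine ⟨?_, h1⟩
  have h3 := ((integrableOn_Ici_iff_integrableOn_Ioi).2 h2)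
  have h4 := IntegrableOn.comp_neg_Iic (c := (0 : ℝ)) (by rw [neg_zero]; exact h3)
  simpa using h4

theorem one_le_prod_aux {N : ℕ} (s : Finset (Fin N)) (f : Fin N → ℝ) (hf : ∀ i, 1 ≤ f i) :
    1 ≤ ∏ i ∈ s, f i :=
  Finset.prod_induction f (fun a => 1 ≤ a) (fun _ _ ha hb => one_le_mul_of_one_le_of_one_le ha hb)
    le_rfl fun i _ => hf i

/-- regularised density -/
noncomputable def RR {N : ℕ} (β c : ℝ) (V : ℝ[X]) (ε : ℝ) (l : Fin N → ℝ) : ℝ :=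
  (∏ i : Fin N, ∏ j ∈ Finset.Ioi i, ((l i - l j) ^ 2 + ε) ^ β) *
    Real.exp (-c * ∑ i, V.eval (l i))

noncomputable def HH {N : ℕ} (V : ℝ[X]) (l : Fin N → ℝ) : ℝ :=
  ∏ i : Fin N, (2 + (V.derivative.eval (l i)) ^ 2)

theorem RR_nonneg {N : ℕ} (β c : ℝ) (V : ℝ[X]) (ε : ℝ) (hε : 0 ≤ ε) (l : Fin N → ℝ) :
    0 ≤ RR β c V ε l := by
  unfold RR
  positivity

theorem HH_ge_one {N : ℕ} (V : ℝ[X]) (l : Fin N → ℝ) : 1 ≤ HH V l := by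
  unfold HH
  apply one_le_prod_aux
  intro i
  nlinarith [sq_nonneg (V.derivative.eval (l i))]

theorem le_prod_aux {N : ℕ} (f : Fin N → ℝ) (hf : ∀ i, 1 ≤ f i) (k : Fin N) : f k ≤ ∏ i, f i := by
  rw [← Finset.mul_prod_erase _ _ (Finset.mem_univ k)]
  refine le_mul_of_one_le_right (by linarith [hf k]) ?_
  apply one_le_prod_aux
  exact hf

theorem le_HH {N : ℕ} (V : ℝ[X]) (l : Fin N → ℝ) (k : Fin N) :
    |V.derivative.eval (l k)| ≤ HH V l := by
  refine le_trans ?_ (le_prod_aux (fun i => 2 + (V.derivative.eval (l i)) ^ 2) ?_ k)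
  · rw [← sq_abs]
    nlinarith [sq_nonneg (|V.derivative.eval (l k)| - 1)]
  · intro i
    nlinarith [sq_nonneg (V.derivative.eval (l i))]

theorem RR_bound {N : ℕ} (β c : ℝ) (hβ : 0 < β) (hc : 0 < c) (V : ℝ[X]) (hVdeg : 2 ≤ V.natDegree)
    (hVeven : Even V.natDegree) (hVlead : 0 < V.leadingCoeff) :
    ∃ D : (Fin N → ℝ) → ℝ, Integrable D ∧ ∀ ε, 0 ≤ ε → ε ≤ 1 → ∀ l, RR β c V ε l * HH V l ≤ D l := by
  obtain ⟨m, hm⟩ := exists_nat_ge β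
  let q : ℝ[X] := (2 + V.derivative ^ 2) * (1 + X ^ 2) ^ (2 * m * (N * N))
  refine ⟨fun l => 2 ^ (m * (N * N)) * ∏ i, (q.eval (l i) * Real.exp (-c * V.eval (l i))), ?_, ?_⟩
  · apply Integrable.const_mul
    exact Integrable.fintype_prod (f := fun _ a => q.eval a * Real.exp (-c * V.eval a))
      fun _ => aux_one V q c hc hVdeg hVeven hVlead
  intro ε h0 h1 l
  set A : ℝ := ∏ k, (1 + (l k) ^ 2) with hA
  have hA1 : 1 ≤ A := by
    apply one_le_prod_aux
    intro i
    nlinarith [sq_nonneg (l i)]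
  have hAk : ∀ k, 1 + (l k) ^ 2 ≤ A := fun k =>
    le_prod_aux (fun k => 1 + (l k) ^ 2) (fun i => by nlinarith [sq_nonneg (l i)]) k
  have hB1 : 1 ≤ (2 * A ^ 2) ^ m := one_le_pow₀ (by nlinarith)
  have hpair : ∀ i j, ((l i - l j) ^ 2 + ε) ^ β ≤ (2 * A ^ 2) ^ m := by
    intro i j
    have h2 : (l i - l j) ^ 2 + ε ≤ 2 * A ^ 2 := by
      have := mul_le_mul (hAk i) (hAk j) (by positivity) (by linarith)
      nlinarith [sq_nonneg (l i + l j), sq_nonneg (l i * l j)]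
    calc ((l i - l j) ^ 2 + ε) ^ β ≤ (2 * A ^ 2) ^ β :=
          Real.rpow_le_rpow (by positivity) h2 hβ.le
      _ ≤ (2 * A ^ 2) ^ (m : ℝ) := Real.rpow_le_rpow_of_exponent_le (by nlinarith) hm
      _ = _ := Real.rpow_natCast _ _
  have hprod : (∏ i : Fin N, ∏ j ∈ Finset.Ioi i, ((l i - l j) ^ 2 + ε) ^ β)
      ≤ ((2 * A ^ 2) ^ m) ^ (N * N) := by
    calc _ ≤ ∏ i : Fin N, ((2 * A ^ 2) ^ m) ^ N := by
          refine Finset.prod_le_prod (fun i _ => by positivity) fun i _ => ?_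
          calc _ ≤ ∏ j ∈ Finset.Ioi i, (2 * A ^ 2) ^ m :=
                Finset.prod_le_prod (fun j _ => by positivity) fun j _ => hpair i j
            _ = ((2 * A ^ 2) ^ m) ^ (Finset.Ioi i).card := by simp
            _ ≤ _ := pow_le_pow_right₀ hB1 (by simpa using Finset.card_le_univ (Finset.Ioi i))
      _ = _ := by simp [← pow_mul, mul_assoc]
  have hH : 0 ≤ HH V l := by linarith [HH_ge_one V l]
  unfold RR
  have key : ((2 * A ^ 2) ^ m) ^ (N * N) * Real.exp (-c * ∑ i, V.eval (l i)) * HH V l =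
      2 ^ (m * (N * N)) * ∏ i, (q.eval (l i) * Real.exp (-c * V.eval (l i))) := by
    rw [Finset.mul_sum, Real.exp_sum, hA, HH]
    simp only [q, eval_mul, eval_pow, eval_add, eval_one, eval_X, eval_ofNat,
      Finset.prod_mul_distrib, Finset.prod_pow]
    ring
  show _ ≤ 2 ^ (m * (N * N)) * ∏ i, (q.eval (l i) * Real.exp (-c * V.eval (l i)))
  rw [← key]
  gcongr

theorem RR_cont_e {N : ℕ} (β c : ℝ) (hβ : 0 < β) (V : ℝ[X]) (l : Fin N → ℝ) :
    Continuous (fun ε : ℝ => RR β c V ε l) := by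
  unfold RR
  refine Continuous.mul ?_ (by fun_prop)
  refine continuous_finsetProd _ fun i _ => continuous_finsetProd _ fun j _ => ?_
  refine Continuous.rpow_const (by fun_prop) fun _ => Or.inr hβ.le

theorem RR_cont_l {N : ℕ} (β c : ℝ) (hβ : 0 < β) (V : ℝ[X]) (ε : ℝ) :
    Continuous (fun l : Fin N → ℝ => RR β c V ε l) := by
  unfold RR
  refine Continuous.mul ?_ (by fun_prop)
  refine continuous_finsetProd _ fun i _ => continuous_finsetProd _ fun j _ => ?_
  refine Continuous.rpow_const (by fun_prop) fun _ => Or.inr hβ.le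

theorem RR_int {N : ℕ} (β c : ℝ) (hβ : 0 < β) (hc : 0 < c) (V : ℝ[X]) (hVdeg : 2 ≤ V.natDegree)
    (hVeven : Even V.natDegree) (hVlead : 0 < V.leadingCoeff) (ε : ℝ) (h0 : 0 ≤ ε) (h1 : ε ≤ 1)
    (f : (Fin N → ℝ) → ℂ) (hf : Measurable f) (K : ℝ) (hK : ∀ l, ‖f l‖ ≤ K * HH V l) :
    Integrable (fun l => (RR β c V ε l : ℂ) * f l) := by
  obtain ⟨D, hD, hb⟩ := RR_bound (N := N) β c hβ hc V hVdeg hVeven hVlead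
  refine Integrable.mono' (hD.const_mul |K|) ?_ ?_
  · have : Continuous (fun l : Fin N → ℝ => RR β c V ε l) :=
      RR_cont_l β c hβ V ε
    have h2 : Measurable (fun l : Fin N → ℝ => (RR β c V ε l : ℂ)) :=
      Complex.measurable_ofReal.comp this.measurable
    exact (h2.mul hf).aestronglyMeasurable
  · refine Filter.Eventually.of_forall fun l => ?_
    have hR := RR_nonneg β c V ε h0 l
    have hH := HH_ge_one V l
    rw [norm_mul, Complex.norm_real, Real.norm_of_nonneg hR]
    calc RR β c V ε l * ‖f l‖ ≤ RR β c V ε l * (|K| * HH V l) := by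
          gcongr
          refine (hK l).trans ?_
          gcongr
          exact le_abs_self K
      _ = |K| * (RR β c V ε l * HH V l) := by ring
      _ ≤ _ := by
          gcongr
          exact hb ε h0 h1 l

noncomputable def PP {N : ℕ} (β c : ℝ) (V : ℝ[X]) (ε : ℝ) (l d : Fin N → ℝ) : ℝ :=
  (∑ i : Fin N, ∑ j ∈ Finset.Ioi i, β * (2 * ((l i - l j) / ((l i - l j) ^ 2 + ε))) * (d i - d j)) -
    c * ∑ i, V.derivative.eval (l i) * d i

theorem RR_exp {N : ℕ} (β c : ℝ) (V : ℝ[X]) (ε : ℝ) (hε : 0 < ε) (l : Fin N → ℝ) :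
    RR β c V ε l = Real.exp ((∑ i : Fin N, ∑ j ∈ Finset.Ioi i, β * Real.log ((l i - l j) ^ 2 + ε)) -
      c * ∑ i, V.eval (l i)) := by
  unfold RR
  rw [sub_eq_add_neg, Real.exp_add, Real.exp_sum, neg_mul]
  congr 1
  refine Finset.prod_congr rfl fun i _ => ?_
  rw [Real.exp_sum]
  refine Finset.prod_congr rfl fun j _ => ?_
  rw [Real.rpow_def_of_pos (by positivity), mul_comm]

theorem RR_deriv {N : ℕ} (β c : ℝ) (V : ℝ[X]) (ε : ℝ) (hε : 0 < ε) (l d : Fin N → ℝ) :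
    HasDerivAt (fun t : ℝ => RR β c V ε (l + t • d)) (RR β c V ε l * PP β c V ε l d) 0 := by
  have hc : ∀ i, HasDerivAt (fun t : ℝ => (l + t • d) i) (d i) 0 := by
    intro i
    simpa using ((hasDerivAt_id (0 : ℝ)).mul_const (d i)).const_add (l i)
  have h0 : l + (0 : ℝ) • d = l := by simp
  have h1 : HasDerivAt (fun t : ℝ => (∑ i : Fin N, ∑ j ∈ Finset.Ioi i,
      β * Real.log (((l + t • d) i - (l + t • d) j) ^ 2 + ε)) -
      c * ∑ i, V.eval ((l + t • d) i)) (PP β c V ε l d) 0 := by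
    unfold PP
    refine HasDerivAt.fun_sub ?_ (HasDerivAt.const_mul c ?_)
    · refine HasDerivAt.fun_sum fun i _ => HasDerivAt.fun_sum fun j _ => ?_
      have hpos : (((l + (0 : ℝ) • d) i - (l + (0 : ℝ) • d) j) ^ 2 + ε) ≠ 0 := by positivity
      have := (((((hc i).fun_sub (hc j)).fun_pow 2).add_const ε).log hpos).const_mul β
      refine this.congr_deriv ?_
      rw [h0]
      push_cast
      ring
    · refine HasDerivAt.fun_sum fun i _ => ?_
      have hV := V.hasDerivAt ((l + (0 : ℝ) • d) i)
      have := HasDerivAt.comp (0 : ℝ) hV (hc i)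
      rw [h0] at this
      exact this
  have h2 := h1.exp
  rw [h0, ← RR_exp β c V ε hε l] at h2
  refine h2.congr_of_eventuallyEq (Filter.Eventually.of_forall fun t => ?_)
  exact RR_exp β c V ε hε _

theorem gg_ne (x : ℂ) (hx : x.im ≠ 0) (a : ℝ) : x - (a : ℂ) ≠ 0 := by
  intro h
  apply hx
  simpa using congrArg Complex.im h

theorem gg_norm (x : ℂ) (hx : x.im ≠ 0) (a : ℝ) : ‖1 / (x - (a : ℂ))‖ ≤ 1 / |x.im| := by
  rw [norm_div, norm_one]
  apply one_div_le_one_div_of_le (abs_pos.2 hx)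
  simpa using Complex.abs_im_le_norm (x - (a : ℂ))

theorem frac_bound (u ε : ℝ) (hε : 0 < ε) : |u / (u ^ 2 + ε)| ≤ 1 / ε + 1 := by
  have h : 0 < u ^ 2 + ε := by positivity
  rw [abs_div, abs_of_pos h, div_le_iff₀ h]
  have h1 : (1 / ε + 1) * (u ^ 2 + ε) = u ^ 2 / ε + 1 + u ^ 2 + ε := by field_simp; ring
  rw [h1, ← sq_abs u]
  have : 0 ≤ |u| ^ 2 / ε := by positivity
  nlinarith [sq_nonneg (|u| - 1)]

theorem IBP {N : ℕ} (β c : ℝ) (hβ : 0 < β) (hc : 0 < c) (V : ℝ[X]) (hVdeg : 2 ≤ V.natDegree)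
    (hVeven : Even V.natDegree) (hVlead : 0 < V.leadingCoeff) (ε : ℝ) (h0 : 0 < ε) (h1 : ε ≤ 1)
    (x : ℂ) (hx : x.im ≠ 0) (k : Fin N) :
    Integrable (fun l : Fin N → ℝ => (RR β c V ε l : ℂ) * ((1 / (x - (l k : ℂ))) ^ 2 +
      (1 / (x - (l k : ℂ))) * (PP β c V ε l (Pi.single k 1) : ℂ))) ∧
    ∫ l : Fin N → ℝ, (RR β c V ε l : ℂ) * ((1 / (x - (l k : ℂ))) ^ 2 +
      (1 / (x - (l k : ℂ))) * (PP β c V ε l (Pi.single k 1) : ℂ)) = 0 := by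
  set G := 1 / |x.im| with hG
  have hGpos : 0 ≤ G := by positivity
  have hd : ∀ i, |(Pi.single k 1 : Fin N → ℝ) i| ≤ 1 := by
    intro i
    by_cases h : i = k
    · subst h; simp
    · simp [h]
  have hS : (0 : ℝ) ≤ ∑ i : Fin N, ∑ j ∈ Finset.Ioi i, β * (2 * (1 / ε + 1)) * 2 :=
    Finset.sum_nonneg fun i _ => Finset.sum_nonneg fun j _ => by positivity
  have hint : Integrable (fun l : Fin N → ℝ => (RR β c V ε l : ℂ) * ((1 / (x - (l k : ℂ))) ^ 2 +
      (1 / (x - (l k : ℂ))) * (PP β c V ε l (Pi.single k 1) : ℂ))) := by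
    refine RR_int β c hβ hc V hVdeg hVeven hVlead ε h0.le h1 _ ?_
      (G ^ 2 + G * ((∑ i : Fin N, ∑ j ∈ Finset.Ioi i, β * (2 * (1 / ε + 1)) * 2) +
        c * ∑ i : Fin N, 1)) ?_
    · unfold PP
      fun_prop
    · intro l
      have hH := HH_ge_one V l
      have hP : |PP β c V ε l (Pi.single k 1)| ≤
          ((∑ i : Fin N, ∑ j ∈ Finset.Ioi i, β * (2 * (1 / ε + 1)) * 2) +
            c * ∑ i : Fin N, 1) * HH V l := by
        unfold PP
        refine (abs_sub _ _).trans ?_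
        rw [add_mul]
        refine add_le_add ?_ ?_
        · refine le_trans ?_ (le_mul_of_one_le_right hS hH)
          refine (Finset.abs_sum_le_sum_abs _ _).trans (Finset.sum_le_sum fun i _ => ?_)
          refine (Finset.abs_sum_le_sum_abs _ _).trans (Finset.sum_le_sum fun j _ => ?_)
          rw [abs_mul, abs_mul, abs_mul, abs_of_pos hβ, abs_two]
          have hfb := frac_bound (l i - l j) ε h0
          have hdd : |(Pi.single k 1 : Fin N → ℝ) i - (Pi.single k 1 : Fin N → ℝ) j| ≤ 2 := by
            refine (abs_sub _ _).trans ?_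
            linarith [hd i, hd j]
          gcongr
        · rw [abs_mul, abs_of_pos hc, mul_assoc, Finset.sum_mul]
          gcongr
          refine (Finset.abs_sum_le_sum_abs _ _).trans (Finset.sum_le_sum fun i _ => ?_)
          rw [abs_mul, one_mul]
          calc _ ≤ |V.derivative.eval (l i)| * 1 := by gcongr; exact hd i
            _ ≤ _ := by rw [mul_one]; exact le_HH V l i
      have hg := gg_norm x hx (l k)
      rw [← hG] at hg
      refine (norm_add_le _ _).trans ?_
      rw [add_mul]
      refine add_le_add ?_ ?_
      · refine le_trans ?_ (le_mul_of_one_le_right (by positivity) hH)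
        rw [norm_pow]
        gcongr
      · rw [norm_mul, Complex.norm_real, Real.norm_eq_abs, mul_assoc]
        gcongr
  have hint0 : Integrable (fun l : Fin N → ℝ => (RR β c V ε l : ℂ) * (1 / (x - (l k : ℂ)))) := by
    refine RR_int β c hβ hc V hVdeg hVeven hVlead ε h0.le h1 _ (by fun_prop) G ?_
    intro l
    refine (gg_norm x hx (l k)).trans ?_
    exact le_mul_of_one_le_right (by positivity) (HH_ge_one V l)
  refine ⟨hint, ?_⟩
  have main := integral_bilinear_hasLineDerivAt_right_eq_neg_left_of_integrable
    (μ := (volume : Measure (Fin N → ℝ))) (f := fun _ => (1 : ℂ)) (f' := fun _ => (0 : ℂ))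
    (g := fun l : Fin N → ℝ => (RR β c V ε l : ℂ) * (1 / (x - (l k : ℂ))))
    (g' := fun l : Fin N → ℝ => (RR β c V ε l : ℂ) * ((1 / (x - (l k : ℂ))) ^ 2 +
      (1 / (x - (l k : ℂ))) * (PP β c V ε l (Pi.single k 1) : ℂ)))
    (v := Pi.single k 1) (B := ContinuousLinearMap.mul ℝ ℂ)
    (by simp) (by simpa using hint) (by simpa using hint0)
    (fun l _ => by
      unfold HasLineDerivAt
      exact hasDerivAt_const _ _)
    (fun l _ => by
      unfold HasLineDerivAt
      have hR := (RR_deriv β c V ε h0 l (Pi.single k 1)).ofReal_comp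
      have hl : HasDerivAt (fun t : ℝ => x - (((l + t • (Pi.single k 1 : Fin N → ℝ)) k : ℝ) : ℂ))
          (-1) 0 := by
        have : HasDerivAt (fun t : ℝ => (l + t • (Pi.single k 1 : Fin N → ℝ)) k) 1 0 := by
          simpa using (hasDerivAt_id (0 : ℝ)).const_add (l k)
        simpa using (this.ofReal_comp).const_sub x
      have hne := gg_ne x hx ((l + (0 : ℝ) • (Pi.single k 1 : Fin N → ℝ)) k)
      have hi := hl.fun_inv hne
      have := hR.fun_mul hi
      simp only [one_div]
      refine this.congr_deriv ?_
      have hne' := gg_ne x hx (l k)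
      simp only [zero_smul, add_zero, Complex.ofReal_mul]
      field_simp
      ring)
  simpa using main

noncomputable def EE {N : ℕ} (β c : ℝ) (V : ℝ[X]) (x : ℂ) (ε : ℝ) (l : Fin N → ℝ) : ℂ :=
  (∑ i, (1 / (x - (l i : ℂ))) ^ 2) +
  (∑ i : Fin N, ∑ j ∈ Finset.Ioi i, ((2 * β * ((l i - l j) ^ 2 / ((l i - l j) ^ 2 + ε)) : ℝ) : ℂ) *
    ((1 / (x - (l i : ℂ))) * (1 / (x - (l j : ℂ))))) -
  c * ∑ i, ((V.derivative.eval (l i) : ℝ) : ℂ) * (1 / (x - (l i : ℂ)))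

noncomputable def E0 {N : ℕ} (β c : ℝ) (V : ℝ[X]) (x : ℂ) (l : Fin N → ℝ) : ℂ :=
  (∑ i, (1 / (x - (l i : ℂ))) ^ 2) +
  (∑ i : Fin N, ∑ j ∈ Finset.Ioi i, ((2 * β : ℝ) : ℂ) *
    ((1 / (x - (l i : ℂ))) * (1 / (x - (l j : ℂ))))) -
  c * ∑ i, ((V.derivative.eval (l i) : ℝ) : ℂ) * (1 / (x - (l i : ℂ)))

theorem lin_sum {N : ℕ} (g : Fin N → ℂ) (a : Fin N → Fin N → ℝ) (v : Fin N → ℝ) (c : ℝ) :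
    ∑ k, g k * (((∑ i : Fin N, ∑ j ∈ Finset.Ioi i, a i j *
        ((Pi.single k 1 : Fin N → ℝ) i - (Pi.single k 1 : Fin N → ℝ) j)) -
        c * ∑ i, v i * (Pi.single k 1 : Fin N → ℝ) i : ℝ) : ℂ) =
      (∑ i : Fin N, ∑ j ∈ Finset.Ioi i, (a i j : ℂ) * (g i - g j)) - c * ∑ i, (v i : ℂ) * g i := by
  have hδ : ∀ i : Fin N, ∑ k, g k * (((Pi.single k 1 : Fin N → ℝ) i : ℝ) : ℂ) = g i := by
    intro i
    rw [Finset.sum_eq_single i]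
    · simp
    · intro b _ hb
      simp [hb.symm]
    · simp
  have e : ∀ k, g k * (((∑ i : Fin N, ∑ j ∈ Finset.Ioi i, a i j *
        ((Pi.single k 1 : Fin N → ℝ) i - (Pi.single k 1 : Fin N → ℝ) j)) -
        c * ∑ i, v i * (Pi.single k 1 : Fin N → ℝ) i : ℝ) : ℂ) =
      (∑ i : Fin N, ∑ j ∈ Finset.Ioi i, (a i j : ℂ) *
        (g k * (((Pi.single k 1 : Fin N → ℝ) i : ℝ) : ℂ) -
         g k * (((Pi.single k 1 : Fin N → ℝ) j : ℝ) : ℂ))) -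
      c * ∑ i, (v i : ℂ) * (g k * (((Pi.single k 1 : Fin N → ℝ) i : ℝ) : ℂ)) := by
    intro k
    rw [Complex.ofReal_sub, mul_sub, Complex.ofReal_mul, Complex.ofReal_sum, Complex.ofReal_sum,
      Finset.mul_sum, mul_left_comm, Finset.mul_sum]
    congr 1
    · refine Finset.sum_congr rfl fun i _ => ?_
      rw [Complex.ofReal_sum, Finset.mul_sum]
      refine Finset.sum_congr rfl fun j _ => ?_
      rw [Complex.ofReal_mul, Complex.ofReal_sub]
      ring
    · congr 1
      refine Finset.sum_congr rfl fun i _ => ?_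
      rw [Complex.ofReal_mul]
      ring
  rw [Finset.sum_congr rfl fun k _ => e k, Finset.sum_sub_distrib, ← Finset.mul_sum]
  congr 1
  · rw [Finset.sum_comm]
    refine Finset.sum_congr rfl fun i _ => ?_
    rw [Finset.sum_comm]
    refine Finset.sum_congr rfl fun j _ => ?_
    rw [← Finset.mul_sum, Finset.sum_sub_distrib, hδ, hδ]
  · congr 1
    rw [Finset.sum_comm]
    refine Finset.sum_congr rfl fun i _ => ?_
    rw [← Finset.mul_sum, hδ]

theorem sum_PP {N : ℕ} (β c : ℝ) (V : ℝ[X]) (ε : ℝ) (h0 : 0 < ε)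
    (x : ℂ) (hx : x.im ≠ 0) (l : Fin N → ℝ) :
    ∑ k, ((1 / (x - (l k : ℂ))) ^ 2 +
      (1 / (x - (l k : ℂ))) * (PP β c V ε l (Pi.single k 1) : ℂ)) = EE β c V x ε l := by
  unfold EE PP
  rw [Finset.sum_add_distrib, add_sub_assoc]
  congr 1
  rw [lin_sum (fun k => 1 / (x - (l k : ℂ)))
    (fun i j => β * (2 * ((l i - l j) / ((l i - l j) ^ 2 + ε))))
    (fun i => V.derivative.eval (l i)) c]
  congr 1
  refine Finset.sum_congr rfl fun i _ => Finset.sum_congr rfl fun j _ => ?_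
  have hi' := gg_ne x hx (l i)
  have hj' := gg_ne x hx (l j)
  have hp : (((l i - l j) ^ 2 + ε : ℝ) : ℂ) ≠ 0 := by
    exact_mod_cast (by positivity : (l i - l j) ^ 2 + ε ≠ 0)
  push_cast at hp ⊢
  field_simp
  ring

theorem EE_bound {N : ℕ} (β c : ℝ) (hβ : 0 < β) (hc : 0 < c) (V : ℝ[X]) (x : ℂ) (hx : x.im ≠ 0) :
    ∃ K, 0 ≤ K ∧ ∀ ε, 0 < ε → ∀ l : Fin N → ℝ, ‖EE β c V x ε l‖ ≤ K * HH V l := by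
  set G := 1 / |x.im| with hG
  have hGpos : 0 ≤ G := by positivity
  have hS : (0 : ℝ) ≤ ∑ i : Fin N, ∑ j ∈ Finset.Ioi i, 2 * β * 1 * (G * G) :=
    Finset.sum_nonneg fun i _ => Finset.sum_nonneg fun j _ => by positivity
  have hS1 : (0 : ℝ) ≤ ∑ i : Fin N, G ^ 2 := Finset.sum_nonneg fun i _ => by positivity
  have hS2 : (0 : ℝ) ≤ ∑ i : Fin N, G := Finset.sum_nonneg fun i _ => hGpos
  refine ⟨(∑ i : Fin N, G ^ 2) + (∑ i : Fin N, ∑ j ∈ Finset.Ioi i, 2 * β * 1 * (G * G)) +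
    c * ∑ i : Fin N, G, add_nonneg (add_nonneg hS1 hS) (mul_nonneg hc.le hS2), ?_⟩
  intro ε h0 l
  have hH := HH_ge_one V l
  have hg : ∀ k, ‖1 / (x - (l k : ℂ))‖ ≤ G := fun k => gg_norm x hx (l k)
  unfold EE
  refine (norm_sub_le _ _).trans ?_
  rw [add_mul]
  refine add_le_add ((norm_add_le _ _).trans ?_) ?_
  · refine le_trans ?_ (le_mul_of_one_le_right (add_nonneg hS1 hS) hH)
    refine add_le_add ?_ ?_
    · refine (norm_sum_le _ _).trans (Finset.sum_le_sum fun i _ => ?_)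
      rw [norm_pow]
      have := hg i
      gcongr
    · refine (norm_sum_le _ _).trans (Finset.sum_le_sum fun i _ => ?_)
      refine (norm_sum_le _ _).trans (Finset.sum_le_sum fun j _ => ?_)
      have hr : (l i - l j) ^ 2 / ((l i - l j) ^ 2 + ε) ≤ 1 := by
        rw [div_le_one (by positivity)]
        linarith
      rw [norm_mul, norm_mul, Complex.norm_real, Real.norm_of_nonneg (by positivity)]
      have := hg i
      have := hg j
      gcongr
  · rw [norm_mul, Complex.norm_real, Real.norm_of_nonneg hc.le, mul_assoc, Finset.sum_mul]
    gcongr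
    refine (norm_sum_le _ _).trans (Finset.sum_le_sum fun i _ => ?_)
    rw [norm_mul, Complex.norm_real, Real.norm_eq_abs, mul_comm]
    exact mul_le_mul (hg i) (le_HH V l i) (by positivity) hGpos

theorem EE_lim {N : ℕ} (β c : ℝ) (hβ : 0 < β) (V : ℝ[X]) (x : ℂ) (l : Fin N → ℝ) :
    Filter.Tendsto (fun ε => (RR β c V ε l : ℂ) * EE β c V x ε l) (nhdsWithin 0 (Set.Ioi 0))
      (nhds ((RR β c V 0 l : ℂ) * E0 β c V x l)) := by
  have hRc : Continuous (fun ε => RR β c V ε l) :=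
    RR_cont_e β c hβ V l
  have hR : Filter.Tendsto (fun ε => (RR β c V ε l : ℂ)) (nhdsWithin 0 (Set.Ioi 0))
      (nhds (RR β c V 0 l : ℂ)) :=
    ((Complex.continuous_ofReal.comp hRc).tendsto 0).mono_left nhdsWithin_le_nhds
  unfold EE E0
  simp only [mul_sub, mul_add]
  refine Filter.Tendsto.sub (Filter.Tendsto.add (hR.mul_const _) ?_) (hR.mul_const _)
  simp only [Finset.mul_sum]
  refine tendsto_finsetSum _ fun i _ => tendsto_finsetSum _ fun j hj => ?_
  by_cases hu : l i - l j = 0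
  · have hz : RR β c V 0 l = 0 := by
      unfold RR
      rw [Finset.prod_eq_zero (Finset.mem_univ i), zero_mul]
      rw [Finset.prod_eq_zero hj]
      rw [hu]
      simp [hβ.ne']
    simp [hu, hz]
  · refine hR.mul (Filter.Tendsto.mul_const _ ?_)
    have : Filter.Tendsto (fun ε : ℝ => 2 * β * ((l i - l j) ^ 2 / ((l i - l j) ^ 2 + ε)))
        (nhdsWithin 0 (Set.Ioi 0)) (nhds (2 * β)) := by
      have h : ContinuousAt (fun ε : ℝ => 2 * β * ((l i - l j) ^ 2 / ((l i - l j) ^ 2 + ε))) 0 := by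
        refine ContinuousAt.mul continuousAt_const (ContinuousAt.div continuousAt_const
          (by fun_prop) ?_)
        simpa using hu
      have h2 := h.tendsto.mono_left (nhdsWithin_le_nhds (s := Set.Ioi 0))
      rwa [add_zero, div_self (pow_ne_zero 2 hu), mul_one] at h2
    exact (Complex.continuous_ofReal.tendsto _).comp this

theorem int_E0 {N : ℕ} (β c : ℝ) (hβ : 0 < β) (hc : 0 < c) (V : ℝ[X]) (hVdeg : 2 ≤ V.natDegree)
    (hVeven : Even V.natDegree) (hVlead : 0 < V.leadingCoeff) (x : ℂ) (hx : x.im ≠ 0) :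
    ∫ l : Fin N → ℝ, (RR β c V 0 l : ℂ) * E0 β c V x l = 0 := by
  obtain ⟨D, hD, hb⟩ := RR_bound (N := N) β c hβ hc V hVdeg hVeven hVlead
  obtain ⟨K, hK0, hK⟩ := EE_bound (N := N) β c hβ hc V x hx
  have hmem : ∀ᶠ ε : ℝ in nhdsWithin 0 (Set.Ioi 0), 0 < ε ∧ ε ≤ 1 := by
    filter_upwards [Ioc_mem_nhdsGT (zero_lt_one : (0 : ℝ) < 1)] with ε h using h
  have hsum : ∀ ε, (fun l : Fin N → ℝ => (RR β c V ε l : ℂ) * ∑ k, ((1 / (x - (l k : ℂ))) ^ 2 +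
      (1 / (x - (l k : ℂ))) * (PP β c V ε l (Pi.single k 1) : ℂ))) = fun l => ∑ k,
      (RR β c V ε l : ℂ) * ((1 / (x - (l k : ℂ))) ^ 2 +
      (1 / (x - (l k : ℂ))) * (PP β c V ε l (Pi.single k 1) : ℂ)) := by
    intro ε
    funext l
    rw [Finset.mul_sum]
  have hEE : ∀ ε, 0 < ε → ε ≤ 1 →
      Integrable (fun l : Fin N → ℝ => (RR β c V ε l : ℂ) * EE β c V x ε l) ∧
      ∫ l : Fin N → ℝ, (RR β c V ε l : ℂ) * EE β c V x ε l = 0 := by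
    intro ε h0 h1
    have hI := fun k : Fin N => IBP β c hβ hc V hVdeg hVeven hVlead ε h0 h1 x hx k
    simp only [← sum_PP β c V ε h0 x hx]
    rw [hsum]
    refine ⟨integrable_finsetSum _ fun k _ => (hI k).1, ?_⟩
    rw [integral_finsetSum _ fun k _ => (hI k).1]
    exact Finset.sum_eq_zero fun k _ => (hI k).2
  have hT := tendsto_integral_filter_of_dominated_convergence
    (F := fun ε (l : Fin N → ℝ) => (RR β c V ε l : ℂ) * EE β c V x ε l)
    (f := fun l : Fin N → ℝ => (RR β c V 0 l : ℂ) * E0 β c V x l)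
    (l := nhdsWithin (0 : ℝ) (Set.Ioi 0)) (μ := volume) (fun l => K * D l)
    (by
      filter_upwards [hmem] with ε h
      exact (hEE ε h.1 h.2).1.aestronglyMeasurable)
    (by
      filter_upwards [hmem] with ε h
      refine Filter.Eventually.of_forall fun l => ?_
      have hR := RR_nonneg β c V ε h.1.le l
      rw [norm_mul, Complex.norm_real, Real.norm_of_nonneg hR]
      calc RR β c V ε l * ‖EE β c V x ε l‖ ≤ RR β c V ε l * (K * HH V l) := by
            gcongr
            exact hK ε h.1 l
        _ = K * (RR β c V ε l * HH V l) := by ring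
        _ ≤ _ := by
            gcongr
            exact hb ε h.1.le h.2 l)
    (hD.const_mul K)
    (Filter.Eventually.of_forall fun l => EE_lim β c hβ V x l)
  refine tendsto_nhds_unique hT (tendsto_const_nhds.congr' ?_)
  filter_upwards [hmem] with ε h
  exact (hEE ε h.1 h.2).2.symm

theorem pair_sum {N : ℕ} (a : Fin N → ℂ) :
    ∑ i : Fin N, ∑ j ∈ Finset.Ioi i, 2 * (a i * a j) = (∑ i, a i) ^ 2 - ∑ i, a i ^ 2 := by
  have h := Finset.sum_sum_Ioi_add_eq_sum_sum_off_diag (fun i j => a i * a j)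
  have h2 : ∀ i : Fin N, ∑ j ∈ Finset.Ioi i, 2 * (a i * a j) =
      ∑ j ∈ Finset.Ioi i, (a j * a i + a i * a j) := fun i =>
    Finset.sum_congr rfl fun j _ => by ring
  simp only [h2]
  rw [h, sq, Finset.sum_mul_sum, ← Finset.sum_sub_distrib]
  refine Finset.sum_congr rfl fun i _ => ?_
  rw [← Finset.sum_add_sum_compl {i}]
  simp only [Finset.sum_singleton]
  rw [sq, add_sub_cancel_left]
  exact Finset.sum_congr rfl fun j _ => mul_comm _ _

theorem beta_ensemble_first_loop_equation
    (N : ℕ) (hN : 0 < N) (β t₀ : ℝ) (hβ : 0 < β) (ht₀ : 0 < t₀)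
    (V : Polynomial ℝ) (hVdeg : 2 ≤ V.natDegree) (hVeven : Even V.natDegree)
    (hVlead : 0 < V.leadingCoeff)
    (μ : Measure (Fin N → ℝ))
    (hμ : μ = volume.withDensity (fun l => ENNReal.ofReal
      ((∏ i : Fin N, ∏ j ∈ Finset.Ioi i, |l i - l j| ^ (2 * β)) *
        Real.exp (-((N : ℝ) * Real.sqrt β / t₀) * ∑ i, V.eval (l i)))))
    (x : ℂ) (hx : x.im ≠ 0) :
    Integrable (fun l : Fin N → ℝ => ∑ i, (1 : ℂ) / (x - (l i : ℂ)) ^ 2) μ ∧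
    Integrable (fun l : Fin N → ℝ => (∑ i, (1 : ℂ) / (x - (l i : ℂ))) ^ 2) μ ∧
    Integrable (fun l : Fin N → ℝ =>
      ∑ i, ((V.derivative.eval (l i) : ℝ) : ℂ) / (x - (l i : ℂ))) μ ∧
    (1 - (β : ℂ)) * ∫ l, (∑ i, (1 : ℂ) / (x - (l i : ℂ)) ^ 2) ∂μ +
        (β : ℂ) * ∫ l, (∑ i, (1 : ℂ) / (x - (l i : ℂ))) ^ 2 ∂μ =
      (((N : ℝ) * Real.sqrt β / t₀ : ℝ) : ℂ) *
        ∫ l, (∑ i, ((V.derivative.eval (l i) : ℝ) : ℂ) / (x - (l i : ℂ))) ∂μ := by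
  set c : ℝ := (N : ℝ) * Real.sqrt β / t₀ with hcdef
  have hc : 0 < c := by
    have : (0 : ℝ) < N := by exact_mod_cast hN
    positivity
  have hdens : ∀ l : Fin N → ℝ, (∏ i : Fin N, ∏ j ∈ Finset.Ioi i, |l i - l j| ^ (2 * β)) *
        Real.exp (-c * ∑ i, V.eval (l i)) = RR β c V 0 l := by
    intro l
    unfold RR
    congr 1
    refine Finset.prod_congr rfl fun i _ => Finset.prod_congr rfl fun j _ => ?_
    rw [add_zero, Real.rpow_mul (abs_nonneg _), Real.rpow_two, sq_abs]
  simp only [hdens] at hμ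
  have hRm : Measurable fun l : Fin N → ℝ => ENNReal.ofReal (RR β c V 0 l) :=
    ENNReal.measurable_ofReal.comp (RR_cont_l β c hβ V 0).measurable
  have hRt : ∀ᵐ l : Fin N → ℝ, ENNReal.ofReal (RR β c V 0 l) < ⊤ :=
    Filter.Eventually.of_forall fun l => ENNReal.ofReal_lt_top
  have hsm : ∀ (f : (Fin N → ℝ) → ℂ) l, (ENNReal.ofReal (RR β c V 0 l)).toReal • f l =
      (RR β c V 0 l : ℂ) * f l := by
    intro f l
    rw [ENNReal.toReal_ofReal (RR_nonneg β c V 0 le_rfl l), Complex.real_smul]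
  have hI : ∀ f : (Fin N → ℝ) → ℂ, ∫ l, f l ∂μ = ∫ l, (RR β c V 0 l : ℂ) * f l := by
    intro f
    rw [hμ, integral_withDensity_eq_integral_toReal_smul hRm hRt]
    simp only [hsm]
  have hint : ∀ f : (Fin N → ℝ) → ℂ, Measurable f → ∀ K, (∀ l, ‖f l‖ ≤ K * HH V l) →
      Integrable f μ := by
    intro f hf K hK
    rw [hμ, integrable_withDensity_iff_integrable_smul' hRm hRt]
    simp only [hsm]
    exact RR_int β c hβ hc V hVdeg hVeven hVlead 0 le_rfl zero_le_one f hf K hK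
  set G := 1 / |x.im| with hG
  have hGpos : 0 ≤ G := by positivity
  have hg : ∀ a : ℝ, ‖1 / (x - (a : ℂ))‖ ≤ G := fun a => gg_norm x hx a
  have i1 : Integrable (fun l : Fin N → ℝ => ∑ i, (1 : ℂ) / (x - (l i : ℂ)) ^ 2) μ := by
    refine hint _ (by fun_prop) (∑ i : Fin N, G ^ 2) fun l => ?_
    refine le_trans ?_ (le_mul_of_one_le_right (by positivity) (HH_ge_one V l))
    refine (norm_sum_le _ _).trans (Finset.sum_le_sum fun i _ => ?_)
    rw [← one_div_pow, norm_pow]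
    have := hg (l i)
    gcongr
  have i2 : Integrable (fun l : Fin N → ℝ => (∑ i, (1 : ℂ) / (x - (l i : ℂ))) ^ 2) μ := by
    refine hint _ (by fun_prop) ((∑ i : Fin N, G) ^ 2) fun l => ?_
    refine le_trans ?_ (le_mul_of_one_le_right (by positivity) (HH_ge_one V l))
    rw [norm_pow]
    gcongr
    exact (norm_sum_le _ _).trans (Finset.sum_le_sum fun i _ => hg (l i))
  have i3 : Integrable (fun l : Fin N → ℝ =>
      ∑ i, ((V.derivative.eval (l i) : ℝ) : ℂ) / (x - (l i : ℂ))) μ := by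
    refine hint _ (by fun_prop) (∑ i : Fin N, G) fun l => ?_
    rw [Finset.sum_mul]
    refine (norm_sum_le _ _).trans (Finset.sum_le_sum fun i _ => ?_)
    rw [div_eq_mul_one_div, norm_mul, Complex.norm_real, Real.norm_eq_abs, mul_comm]
    exact mul_le_mul (hg _) (le_HH V l i) (by positivity) hGpos
  refine ⟨i1, i2, i3, ?_⟩
  have hE := int_E0 (N := N) β c hβ hc V hVdeg hVeven hVlead x hx
  rw [← hI] at hE
  have hEeq : ∀ l : Fin N → ℝ, E0 β c V x l =
      (1 - (β : ℂ)) * (∑ i, (1 : ℂ) / (x - (l i : ℂ)) ^ 2) +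
      (β : ℂ) * (∑ i, (1 : ℂ) / (x - (l i : ℂ))) ^ 2 -
      (c : ℂ) * ∑ i, ((V.derivative.eval (l i) : ℝ) : ℂ) / (x - (l i : ℂ)) := by
    intro l
    have hp := pair_sum (fun i => 1 / (x - (l i : ℂ)))
    have hp2 : (∑ i : Fin N, ∑ j ∈ Finset.Ioi i, ((2 * β : ℝ) : ℂ) *
        ((1 / (x - (l i : ℂ))) * (1 / (x - (l j : ℂ))))) = (β : ℂ) *
        ((∑ i, 1 / (x - (l i : ℂ))) ^ 2 - ∑ i, (1 / (x - (l i : ℂ))) ^ 2) := by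
      rw [← hp, Finset.mul_sum]
      refine Finset.sum_congr rfl fun i _ => ?_
      rw [Finset.mul_sum]
      refine Finset.sum_congr rfl fun j _ => ?_
      push_cast
      ring
    unfold E0
    rw [hp2]
    simp only [one_div_pow, ← div_eq_mul_one_div]
    ring
  simp only [hEeq] at hE
  have i12 : Integrable (fun l : Fin N → ℝ =>
      (1 - (β : ℂ)) * (∑ i, (1 : ℂ) / (x - (l i : ℂ)) ^ 2) +
      (β : ℂ) * (∑ i, (1 : ℂ) / (x - (l i : ℂ))) ^ 2) μ := (i1.const_mul _).add (i2.const_mul _)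
  rw [integral_sub i12 (i3.const_mul _),
    integral_add (i1.const_mul _) (i2.const_mul _), integral_const_mul, integral_const_mul,
    integral_const_mul] at hE
  exact sub_eq_zero.1 hE
end

section
/- Let I ⊆ ℝ be an open interval and Ω ⊆ ℂ an open set. Let ħ : I → ℂ be differentiable and nowhere zero, and let ψ : I × Ω → ℂ and U : I × Ω → ℂ be smooth (all partial derivatives in t ∈ I and x ∈ Ω of the relevant orders exist, are continuous, and mixed partials commute), with ψ nowhere vanishing, such that ħ(t)²·∂ₓ²ψ(t,x) = U(t,x)·ψ(t,x) for all (t,x) ∈ I × Ω. Define f(t,x) := ∂ₜψ(t,x)/ψ(t,x). Then for all (t,x) ∈ I × Ω: ħ(t)² · ∂ₓ( ψ(t,x)² · ∂ₓf(t,x) ) = ( ∂ₜU(t,x) − 2·(ħ′(t)/ħ(t))·U(t,x) ) · ψ(t,x)². -/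
/-- Deformation equation for the Schrödinger equation: if `hbar(t)²·∂ₓ²ψ = U·ψ` on
`I × Ω`, with `hbar` differentiable and nowhere zero and `ψ` nowhere vanishing and smooth
(all indicated partial derivatives exist and mixed partials commute), then
`f = ∂ₜψ/ψ` satisfies `hbar² ∂ₓ(ψ² ∂ₓ f) = (∂ₜU - 2(hbar'/hbar)U) ψ²`. -/
theorem schroedinger_deformation_equation
    (I : Set ℝ) (hI : ∃ a b : ℝ, I = Set.Ioo a b)
    (Ω : Set ℂ) (hΩ : IsOpen Ω)
    (hbar hbar' : ℝ → ℂ)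
    (hhbar : ∀ t ∈ I, HasDerivAt hbar (hbar' t) t)
    (hhbar0 : ∀ t ∈ I, hbar t ≠ 0)
    (ψ ψt ψx ψxx ψtx ψtxx U Ut : ℝ → ℂ → ℂ)
    (hψ0 : ∀ t ∈ I, ∀ x ∈ Ω, ψ t x ≠ 0)
    (hψt : ∀ t ∈ I, ∀ x ∈ Ω, HasDerivAt (fun t' => ψ t' x) (ψt t x) t)
    (hψx : ∀ t ∈ I, ∀ x ∈ Ω, HasDerivAt (fun x' => ψ t x') (ψx t x) x)
    (hψxx : ∀ t ∈ I, ∀ x ∈ Ω, HasDerivAt (fun x' => ψx t x') (ψxx t x) x)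
    (hψtx : ∀ t ∈ I, ∀ x ∈ Ω, HasDerivAt (fun x' => ψt t x') (ψtx t x) x)
    (hψxt : ∀ t ∈ I, ∀ x ∈ Ω, HasDerivAt (fun t' => ψx t' x) (ψtx t x) t)
    (hψtxx : ∀ t ∈ I, ∀ x ∈ Ω, HasDerivAt (fun x' => ψtx t x') (ψtxx t x) x)
    (hψxxt : ∀ t ∈ I, ∀ x ∈ Ω, HasDerivAt (fun t' => ψxx t' x) (ψtxx t x) t)
    (hUt : ∀ t ∈ I, ∀ x ∈ Ω, HasDerivAt (fun t' => U t' x) (Ut t x) t)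
    (hSch : ∀ t ∈ I, ∀ x ∈ Ω, (hbar t) ^ 2 * ψxx t x = U t x * ψ t x) :
    ∀ t ∈ I, ∀ x ∈ Ω,
      (hbar t) ^ 2 *
          deriv (fun x' => (ψ t x') ^ 2 * deriv (fun x'' => ψt t x'' / ψ t x'') x') x =
        (Ut t x - 2 * (hbar' t / hbar t) * U t x) * (ψ t x) ^ 2 := by
  intro t ht x hx
  have hI' : IsOpen I := by
    obtain ⟨a, b, rfl⟩ := hI
    exact isOpen_Ioo
  have e1 : (fun x' => (ψ t x') ^ 2 * deriv (fun x'' => ψt t x'' / ψ t x'') x')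
      =ᶠ[nhds x] fun x' => ψtx t x' * ψ t x' - ψt t x' * ψx t x' := by
    filter_upwards [hΩ.mem_nhds hx] with y hy
    have h := ((hψtx t ht y hy).fun_div (hψx t ht y hy) (hψ0 t ht y hy)).deriv
    rw [h]
    have := hψ0 t ht y hy
    field_simp
  have e2 := (((hψtxx t ht x hx).fun_mul (hψx t ht x hx)).fun_sub
    ((hψtx t ht x hx).fun_mul (hψxx t ht x hx))).deriv
  rw [e1.deriv_eq, e2]
  have e3 : (fun t' => hbar t' ^ 2 * ψxx t' x) =ᶠ[nhds t] fun t' => U t' x * ψ t' x := by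
    filter_upwards [hI'.mem_nhds ht] with s hs
    exact hSch s hs x hx
  have e4 := (((hhbar t ht).fun_pow 2).fun_mul (hψxxt t ht x hx)).deriv
  rw [e3.deriv_eq, ((hUt t ht x hx).fun_mul (hψt t ht x hx)).deriv] at e4
  have h0 := hhbar0 t ht
  have e5 := hSch t ht x hx
  have e6 : hbar' t / hbar t * (U t x * ψ t x) = hbar' t * hbar t * ψxx t x := by
    rw [← e5]
    field_simp
  norm_num at e4
  linear_combination (-ψ t x) * e4 + (-ψt t x) * e5 + 2 * ψ t x * e6
end
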